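/- Let R, S, T be finite binary relations on a set V satisfying the composition-closure property: for all x,z,y, if (x,z) ∈ R and (z,y) ∈ S then (x,y) ∈ T. Then Σ_{(x,z) ∈ R} min(|{y : (z,y) ∈ S}|, |{y : (x,y) ∈ T}|) ≤ |R|^{1/2} · |S|^{1/2} · |T|^{1/2}. -/

import Mathlib

/-- The products of out-degrees `deg_S z * deg_T x` over the pairs `(x, z) ∈ R` sum to at most
`|S| * |T|`: the sets counted are disjoint subsets of `S × T`. -/
theorem sum_card_filter_mul_card_filter_le {V : Type*} [DecidableEq V] (R S T : Finset (V × V)) :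
    ∑ p ∈ R, (S.filter (fun q => q.1 = p.2)).card * (T.filter (fun q => q.1 = p.1)).card ≤
      S.card * T.card := by
  simp_rw [← Finset.card_product, ← Finset.card_sigma]
  refine Finset.card_le_card_of_injOn (fun a => a.2) ?_ ?_
  · rintro ⟨p, q⟩ ha
    simp only [Finset.coe_sigma, Set.mem_sigma_iff, Finset.mem_coe, Finset.mem_product,
      Finset.mem_filter] at ha ⊢
    exact ⟨ha.2.1.1, ha.2.2.1⟩
  · rintro ⟨⟨x, z⟩, q⟩ ha ⟨⟨x', z'⟩, q'⟩ hb hab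
    simp only [Finset.coe_sigma, Set.mem_sigma_iff, Finset.mem_coe, Finset.mem_product,
      Finset.mem_filter] at ha hb hab
    subst hab
    obtain rfl : x = x' := ha.2.2.2.symm.trans hb.2.2.2
    obtain rfl : z = z' := ha.2.1.2.symm.trans hb.2.1.2
    rfl

theorem stmt_11 {V : Type*} [DecidableEq V] (R S T : Finset (V × V))
    -- composition-closure: `R ∘ S ⊆ T`
    (h : ∀ x z y : V, (x, z) ∈ R → (z, y) ∈ S → (x, y) ∈ T) :
    (∑ p ∈ R, (min ((S.filter (fun q => q.1 = p.2)).card : ℝ)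
        ((T.filter (fun q => q.1 = p.1)).card : ℝ))) ≤
      Real.sqrt (R.card : ℝ) * Real.sqrt (S.card : ℝ) * Real.sqrt (T.card : ℝ) := by
  rw [mul_assoc, ← Real.sqrt_mul (Nat.cast_nonneg _), ← Real.sqrt_mul (Nat.cast_nonneg _)]
  refine Real.le_sqrt_of_sq_le (sq_sum_le_card_mul_sum_sq.trans ?_)
  gcongr
  calc ∑ p ∈ R, (min ((S.filter (fun q => q.1 = p.2)).card : ℝ)
        ((T.filter (fun q => q.1 = p.1)).card : ℝ)) ^ 2
      ≤ ∑ p ∈ R, ((S.filter (fun q => q.1 = p.2)).card : ℝ) *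
          ((T.filter (fun q => q.1 = p.1)).card : ℝ) := by
        refine Finset.sum_le_sum fun p _ => ?_
        rw [sq]
        exact mul_le_mul (min_le_left _ _) (min_le_right _ _) (by positivity) (by positivity)
    _ ≤ (S.card : ℝ) * T.card := by
        exact_mod_cast sum_card_filter_mul_card_filter_le R S T
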